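/- Let i₁ < i₂ be real numbers, N ∈ ℕ, h = (i₂ − i₁)/(N + 1), and let s₀, …, s_{N+1} : ℝ → ℝ be the spline (hat) functions associated with these data. Let n ≥ 1, M ≥ 0, θ ≥ 0, and let y : ℝ → ℝⁿ be such that y is differentiable on [i₁, i₂], its derivative y' is differentiable on [i₁, i₂], and ‖y''(t)‖ ≤ M for every t ∈ [i₁, i₂]. Let ỹ₀, …, ỹ_{N+1} ∈ ℝⁿ satisfy ‖ỹ_i − y(i₁ + i·h)‖ ≤ θ for every 0 ≤ i ≤ N + 1. Then for every t ∈ [i₁, i₂], ‖y(t) − Σ_{i=0}^{N+1} ỹ_i·s_i(t)‖ ≤ h²·M/8 + (N + 2)·θ. -/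

import Mathlib

open scoped Classical

/-- The first-order spline (hat) functions of equation (27): for `i₁ < i₂`,
`N ∈ ℕ`, node spacing `h = (i₂ − i₁)/(N+1)`, `spline i₁ i₂ N i` is the `i`-th
hat function (`0 ≤ i ≤ N+1`). -/
noncomputable def spline (i₁ i₂ : ℝ) (N : ℕ) (i : ℕ) (t : ℝ) : ℝ :=
  let h : ℝ := (i₂ - i₁) / (N + 1)
  if i = 0 then
    if t ∈ Set.Icc i₁ (i₁ + h) then 1 - (t - i₁) / h else 0
  else if i = N + 1 then
    if t ∈ Set.Icc (i₂ - h) i₂ then 1 + (t - i₂) / h else 0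
  else
    if t ∈ Set.Icc (i₁ + ((i : ℝ) - 1) * h) (i₁ + (i : ℝ) * h) then
      1 - (i : ℝ) + (t - i₁) / h
    else if t ∈ Set.Icc (i₁ + (i : ℝ) * h) (i₁ + ((i : ℝ) + 1) * h) then
      1 + (i : ℝ) - (t - i₁) / h
    else 0

/-- Writing `u = (t - i₁) / h` for the rescaled position, on `[i₁, i₂]` the `i`-th spline is the
tent function `max 0 (1 - |u - i|)`. -/
theorem spline_eq_max {i₁ i₂ : ℝ} (hi : i₁ < i₂) {N : ℕ} {h : ℝ} (hh : h = (i₂ - i₁) / (N + 1))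
    {u : ℝ} (hu : u ∈ Set.Icc 0 ((N : ℝ) + 1)) {i : ℕ} (hiN : i ≤ N + 1) :
    spline i₁ i₂ N i (i₁ + u * h) = max 0 (1 - |u - i|) := by
  have hN : (0 : ℝ) < N + 1 := by positivity
  have hpos : 0 < h := hh ▸ div_pos (sub_pos.2 hi) hN
  have hi₂ : i₂ = i₁ + (N + 1) * h := by
    rw [hh]
    field_simp
    ring
  obtain ⟨hu₀, hu₁⟩ := hu
  have hmem : ∀ a b : ℝ, i₁ + u * h ∈ Set.Icc (i₁ + a * h) (i₁ + b * h) ↔ a ≤ u ∧ u ≤ b := by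
    intro a b
    simp [hpos]
  have hdiv : (i₁ + u * h - i₁) / h = u := by
    rw [add_sub_cancel_left, mul_div_cancel_right₀ _ hpos.ne']
  have hfirst : i₁ + u * h ∈ Set.Icc i₁ (i₁ + h) ↔ 0 ≤ u ∧ u ≤ 1 := by
    simpa using hmem 0 1
  have hlast : i₁ + u * h ∈ Set.Icc (i₂ - h) i₂ ↔ (N : ℝ) ≤ u ∧ u ≤ N + 1 := by
    rw [← hmem, ← hi₂, show i₂ - h = i₁ + N * h by rw [hi₂]; ring]
  have hdiv_last : (i₁ + u * h - i₂) / h = u - (N + 1) := by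
    rw [hi₂, div_eq_iff hpos.ne']
    ring
  simp only [spline, ← hh, hfirst, hlast, hmem, hdiv, hdiv_last]
  split_ifs
  all_goals
    subst_vars
    push_cast
    grind

/-- One-sided error bound for linear interpolation of a function whose second derivative is bounded
below. -/
theorem sub_lineMap_le_of_neg_le_deriv2 {a b M : ℝ} (hab : a ≤ b) (hM : 0 ≤ M)
    {f f' f'' : ℝ → ℝ} (hf : ∀ t ∈ Set.Icc a b, HasDerivAt f (f' t) t)
    (hf' : ∀ t ∈ Set.Icc a b, HasDerivAt f' (f'' t) t) (hf'' : ∀ t ∈ Set.Icc a b, -M ≤ f'' t)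
    {v : ℝ} (hv : v ∈ Set.Icc (0 : ℝ) 1) :
    f ((1 - v) * a + v * b) - ((1 - v) * f a + v * f b) ≤ (b - a) ^ 2 * M / 8 := by
  have hconv : ConvexOn ℝ (Set.Icc a b) fun t ↦ f t + M / 2 * t ^ 2 := by
    refine convexOn_of_hasDerivWithinAt2_nonneg (convex_Icc a b) (f' := fun t ↦ f' t + M * t)
      (f'' := fun t ↦ f'' t + M) ?_ ?_ ?_ ?_
    · exact fun t ht ↦ ((hf t ht).continuousAt.add (by fun_prop)).continuousWithinAt
    · intro t ht
      refine (((hf t (interior_subset ht)).add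
        (((hasDerivAt_id t).pow 2).const_mul (M / 2))).congr_deriv ?_).hasDerivWithinAt
      simp
      ring
    · intro t ht
      refine (((hf' t (interior_subset ht)).add
        ((hasDerivAt_id t).const_mul M)).congr_deriv ?_).hasDerivWithinAt
      simp
    · intro t ht
      linarith [hf'' t (interior_subset ht)]
  have key := hconv.2 (Set.left_mem_Icc.2 hab) (Set.right_mem_Icc.2 hab) (sub_nonneg.2 hv.2) hv.1
    (sub_add_cancel 1 v)
  simp only [smul_eq_mul] at key
  nlinarith [mul_nonneg hM (sq_nonneg ((b - a) * (2 * v - 1)))]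

/-- Error bound for linear interpolation of a function into `ℝⁿ` with the maximum norm. -/
theorem norm_sub_lineMap_le_of_norm_deriv2_le {ι : Type*} [Fintype ι] {a b M : ℝ} (hab : a ≤ b)
    {f f' f'' : ℝ → ι → ℝ} (hf : ∀ t ∈ Set.Icc a b, HasDerivAt f (f' t) t)
    (hf' : ∀ t ∈ Set.Icc a b, HasDerivAt f' (f'' t) t) (hf'' : ∀ t ∈ Set.Icc a b, ‖f'' t‖ ≤ M)
    {v : ℝ} (hv : v ∈ Set.Icc (0 : ℝ) 1) :
    ‖f ((1 - v) * a + v * b) - ((1 - v) • f a + v • f b)‖ ≤ (b - a) ^ 2 * M / 8 := by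
  have hM : 0 ≤ M := (norm_nonneg _).trans (hf'' a (Set.left_mem_Icc.2 hab))
  refine (pi_norm_le_iff_of_nonneg (by positivity)).2 fun j ↦ ?_
  have hj t (ht : t ∈ Set.Icc a b) : |f'' t j| ≤ M := (norm_le_pi_norm _ j).trans (hf'' t ht)
  have hfj t (ht : t ∈ Set.Icc a b) := hasDerivAt_pi.1 (hf t ht) j
  have hfj' t (ht : t ∈ Set.Icc a b) := hasDerivAt_pi.1 (hf' t ht) j
  have upper := sub_lineMap_le_of_neg_le_deriv2 hab hM hfj hfj'
    (fun t ht ↦ neg_le_of_abs_le (hj t ht)) hv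
  have lower := sub_lineMap_le_of_neg_le_deriv2 hab hM (fun t ht ↦ (hfj t ht).neg)
    (fun t ht ↦ (hfj' t ht).neg) (fun t ht ↦ neg_le_neg (le_of_abs_le (hj t ht))) hv
  simp only [Pi.neg_apply] at lower
  simp only [Pi.sub_apply, Pi.add_apply, Pi.smul_apply, smul_eq_mul, Real.norm_eq_abs]
  exact abs_le.2 ⟨by linarith, upper⟩

/-- Approximation property of Lemma 6.2 (for twice differentiable functions):
the quantized first-order spline `Σᵢ ỹᵢ sᵢ(t)` with node accuracy `θ`
approximates `y` within `Λ(N, θ, M) = h²M/8 + (N+2)θ` in sup norm on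
`[i₁, i₂]`. `ℝⁿ` carries the infinity (max) norm. -/
theorem spline_approximation_error
    (i₁ i₂ : ℝ) (hi : i₁ < i₂) (N : ℕ) (h : ℝ) (hh : h = (i₂ - i₁) / (N + 1))
    (n : ℕ) (hn : 1 ≤ n) (M θ : ℝ) (hM : 0 ≤ M) (hθ : 0 ≤ θ)
    (y y' y'' : ℝ → (Fin n → ℝ))
    (hy : ∀ t ∈ Set.Icc i₁ i₂, HasDerivAt y (y' t) t)
    (hy' : ∀ t ∈ Set.Icc i₁ i₂, HasDerivAt y' (y'' t) t)
    (hy'' : ∀ t ∈ Set.Icc i₁ i₂, ‖y'' t‖ ≤ M)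
    (yq : ℕ → (Fin n → ℝ))
    (hq : ∀ i ≤ N + 1, ‖yq i - y (i₁ + (i : ℝ) * h)‖ ≤ θ) :
    ∀ t ∈ Set.Icc i₁ i₂,
      ‖y t - ∑ i ∈ Finset.range (N + 2), spline i₁ i₂ N i t • yq i‖ ≤
        h ^ 2 * M / 8 + (N + 2) * θ := by
  intro t ht
  have hN : (0 : ℝ) < N + 1 := by positivity
  have hpos : 0 < h := hh ▸ div_pos (sub_pos.2 hi) hN
  have hi₂ : i₂ = i₁ + (N + 1) * h := by
    rw [hh]
    field_simp
    ring
  obtain ⟨u, rfl⟩ : ∃ u, t = i₁ + u * h := ⟨(t - i₁) / h, by field_simp; ring⟩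
  have hu₀ : 0 ≤ u := nonneg_of_mul_nonneg_left (by linarith [ht.1]) hpos
  have hu₁ : u ≤ N + 1 := le_of_mul_le_mul_right (by linarith [ht.2]) hpos
  obtain ⟨k, hkN, hku, huk⟩ : ∃ k ≤ N, (k : ℝ) ≤ u ∧ u ≤ k + 1 := by
    rcases le_total u N with huN | huN
    · exact ⟨⌊u⌋₊, Nat.floor_le_of_le huN, Nat.floor_le hu₀, (Nat.lt_floor_add_one u).le⟩
    · exact ⟨N, le_rfl, huN, hu₁⟩
  have hkN' : (k : ℝ) ≤ N := by exact_mod_cast hkN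
  have hs i (hiN : i ≤ N + 1) := spline_eq_max hi hh ⟨hu₀, hu₁⟩ hiN
  have hsum : ∑ i ∈ Finset.range (N + 2), spline i₁ i₂ N i (i₁ + u * h) • yq i =
      (1 - (u - k)) • yq k + (u - k) • yq (k + 1) := by
    rw [Finset.sum_eq_add_of_mem k (k + 1) (by simp; lia) (by simp; lia) (by lia)]
    · rw [hs k (by lia), hs (k + 1) (by lia), abs_of_nonneg (by linarith),
        abs_of_nonpos (by push_cast; linarith), max_eq_right (by linarith),
        max_eq_right (by push_cast; linarith)]
      push_cast
      congr 2
      ring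
    · rintro i hiN ⟨hik, hik'⟩
      rw [hs i (by simp at hiN; lia), max_eq_left, zero_smul]
      rw [sub_nonpos, le_abs]
      rcases lt_or_gt_of_ne hik with hlt | hgt
      · have : (i : ℝ) + 1 ≤ k := by exact_mod_cast hlt
        left
        linarith
      · have : (k : ℝ) + 1 + 1 ≤ i := by exact_mod_cast (show k + 1 + 1 ≤ i by lia)
        right
        linarith
  have hsub : Set.Icc (i₁ + k * h) (i₁ + (k + 1 : ℕ) * h) ⊆ Set.Icc i₁ i₂ := by
    refine Set.Icc_subset_Icc (by simpa using by positivity) ?_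
    rw [hi₂]
    push_cast
    gcongr
  have hv : u - k ∈ Set.Icc (0 : ℝ) 1 := ⟨by linarith, by linarith⟩
  have hinterp := norm_sub_lineMap_le_of_norm_deriv2_le (a := i₁ + k * h)
    (b := i₁ + (k + 1 : ℕ) * h) (by gcongr; lia) (fun t ht ↦ hy t (hsub ht))
    (fun t ht ↦ hy' t (hsub ht)) (fun t ht ↦ hy'' t (hsub ht)) hv
  have hpt : (1 - (u - k)) * (i₁ + k * h) + (u - k) * (i₁ + (k + 1 : ℕ) * h) = i₁ + u * h := by
    push_cast
    ring
  have hlen : i₁ + (k + 1 : ℕ) * h - (i₁ + k * h) = h := by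
    push_cast
    ring
  rw [hpt, hlen] at hinterp
  have hquant : ‖((1 - (u - k)) • yq k + (u - k) • yq (k + 1)) -
      ((1 - (u - k)) • y (i₁ + k * h) + (u - k) • y (i₁ + (k + 1 : ℕ) * h))‖ ≤ θ := by
    rw [add_sub_add_comm, ← smul_sub, ← smul_sub]
    have hball := convex_closedBall (0 : Fin n → ℝ) θ
      (mem_closedBall_zero_iff.2 (hq k (by lia))) (mem_closedBall_zero_iff.2 (hq (k + 1) (by lia)))
      (sub_nonneg.2 hv.2) hv.1 (sub_add_cancel 1 _)
    exact mem_closedBall_zero_iff.1 hball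
  rw [hsum, ← sub_sub_sub_cancel_right]
  calc _ ≤ _ := norm_sub_le _ _
    _ ≤ h ^ 2 * M / 8 + θ := add_le_add hinterp hquant
    _ ≤ h ^ 2 * M / 8 + (N + 2) * θ := by nlinarith
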